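/- Let (X_n)_{n≥1} be an infinite exchangeable sequence of random variables with values in a Polish space X, with law P and predictive rule (P_n)_{n≥0}. Then, with P-probability one, as n→∞ the sequence of predictive distributions P_n converges weakly, and its limit coincides with the P-a.s. weak limit F̃ of the empirical distributions: P_n → F̃ P-a.s. -/

import Mathlib

open MeasureTheory ProbabilityTheory Filter Topology
open scoped ENNReal NNReal

/-- A sequence of random variables is exchangeable if its joint law is invariant under every
finite permutation of the indices. -/
def Exchangeable {Ω 𝕏 : Type*} [MeasurableSpace Ω] [MeasurableSpace 𝕏]
    (μ : Measure Ω) (X : ℕ → Ω → 𝕏) : Prop :=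
  ∀ σ : Equiv.Perm ℕ, {n | σ n ≠ n}.Finite →
    Measure.map (fun ω => fun n => X (σ n) ω) μ = Measure.map (fun ω => fun n => X n ω) μ

/-- The empirical distribution `F̂_n = (1/n) ∑_{i=1}^n δ_{X_i}`. -/
noncomputable def empMeas {Ω 𝕏 : Type*} [MeasurableSpace Ω] [MeasurableSpace 𝕏]
    (X : ℕ → Ω → 𝕏) (n : ℕ) (ω : Ω) : Measure 𝕏 :=
  (n : ℝ≥0∞)⁻¹ • ∑ i ∈ Finset.range n, Measure.dirac (X i ω)

/-- Weak convergence of a sequence of measures, phrased via integrals of bounded continuous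
functions. -/
def TendstoWeakly {𝕏 : Type*} [MeasurableSpace 𝕏] [TopologicalSpace 𝕏]
    (ν : ℕ → Measure 𝕏) (ρ : Measure 𝕏) : Prop :=
  ∀ f : BoundedContinuousFunction 𝕏 ℝ,
    Tendsto (fun n => ∫ x, f x ∂(ν n)) atTop (𝓝 (∫ x, f x ∂ρ))

/-- `(P n)_{n≥0}` is (a version of) the predictive rule of the sequence `X` under `μ`. -/
def IsPredictiveRule {Ω 𝕏 : Type*} [MeasurableSpace Ω] [MeasurableSpace 𝕏]
    (μ : Measure Ω) (X : ℕ → Ω → 𝕏)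
    (P : (n : ℕ) → Kernel (Fin n → 𝕏) 𝕏) : Prop :=
  ∀ (n : ℕ) (A : Set 𝕏) (B : Set (Fin n → 𝕏)), MeasurableSet A → MeasurableSet B →
    μ {ω | (fun i : Fin n => X i ω) ∈ B ∧ X n ω ∈ A}
      = ∫⁻ x in B, P n x A ∂(Measure.map (fun ω (i : Fin n) => X i ω) μ)

/-- The proportion of the first `n` terms of the sequence `x` that lie in `s`. -/
noncomputable def sampleFreq {𝕏 : Type*} (s : Set 𝕏) (n : ℕ) (x : ℕ → 𝕏) : ℝ :=
  (∑ i ∈ Finset.range n, s.indicator (fun _ => (1 : ℝ)) (x i)) / n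

/-- The upper limiting frequency of visits of the sequence `x` to `s`. -/
noncomputable def limFreq {𝕏 : Type*} (s : Set 𝕏) (x : ℕ → 𝕏) : ℝ :=
  limsup (fun n => sampleFreq s n x) atTop

section Deterministic

variable {𝕏 : Type*}

lemma indicator_one_mem_Icc (s : Set 𝕏) (x : 𝕏) :
    s.indicator (fun _ => (1 : ℝ)) x ∈ Set.Icc (0 : ℝ) 1 := by
  by_cases h : x ∈ s <;> simp [h]

lemma sampleFreq_nonneg (s : Set 𝕏) (n : ℕ) (x : ℕ → 𝕏) : 0 ≤ sampleFreq s n x :=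
  div_nonneg (Finset.sum_nonneg fun i _ => (indicator_one_mem_Icc s (x i)).1) n.cast_nonneg

lemma sampleFreq_le_one (s : Set 𝕏) (n : ℕ) (x : ℕ → 𝕏) : sampleFreq s n x ≤ 1 := by
  refine div_le_one_of_le₀ ?_ n.cast_nonneg
  calc _ ≤ ∑ i ∈ Finset.range n, (1 : ℝ) :=
        Finset.sum_le_sum fun i _ => (indicator_one_mem_Icc s (x i)).2
    _ = n := by simp

lemma norm_sampleFreq_le_one (s : Set 𝕏) (n : ℕ) (x : ℕ → 𝕏) : ‖sampleFreq s n x‖ ≤ 1 := by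
  rw [Real.norm_of_nonneg (sampleFreq_nonneg s n x)]
  exact sampleFreq_le_one s n x

lemma norm_limFreq_le_one (s : Set 𝕏) (x : ℕ → 𝕏) : ‖limFreq s x‖ ≤ 1 := by
  have hb : IsBoundedUnder (· ≤ ·) atTop (fun n => sampleFreq s n x) :=
    isBoundedUnder_of ⟨1, fun n => sampleFreq_le_one s n x⟩
  have hb' : IsBoundedUnder (· ≥ ·) atTop (fun n => sampleFreq s n x) :=
    isBoundedUnder_of ⟨0, fun n => sampleFreq_nonneg s n x⟩
  rw [Real.norm_eq_abs, abs_le]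
  constructor
  · refine le_trans (by norm_num) (le_limsup_of_frequently_le (a := (0 : ℝ)) ?_ hb)
    exact Frequently.of_forall fun n => sampleFreq_nonneg s n x
  · exact limsup_le_of_le hb'.isCoboundedUnder_le (.of_forall fun n => sampleFreq_le_one s n x)

lemma limFreq_perm (s : Set 𝕏) (x : ℕ → 𝕏) {σ : Equiv.Perm ℕ} (hσ : {n | σ n ≠ n}.Finite) :
    limFreq s (fun n => x (σ n)) = limFreq s x := by
  obtain ⟨N, hN⟩ := hσ.bddAbove
  refine limsup_congr ?_
  filter_upwards [eventually_gt_atTop N] with n hn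
  unfold sampleFreq
  congr 1
  refine Equiv.Perm.sum_comp σ (Finset.range n)
    (fun i => s.indicator (fun _ => (1 : ℝ)) (x i)) fun i hi => ?_
  simpa using (hN hi).trans_lt hn

variable [MeasurableSpace 𝕏]

lemma measurable_sampleFreq {s : Set 𝕏} (hs : MeasurableSet s) (n : ℕ) :
    Measurable (sampleFreq s n) := by
  unfold sampleFreq
  refine Measurable.div_const (Finset.measurable_fun_sum _ fun i _ => ?_) _
  exact (measurable_const.indicator hs).comp (measurable_pi_apply i)

lemma measurable_limFreq {s : Set 𝕏} (hs : MeasurableSet s) : Measurable (limFreq s) :=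
  Measurable.limsup fun n => measurable_sampleFreq hs n

end Deterministic

lemma finite_setOf_swap_ne (j k : ℕ) : {n | Equiv.swap j k n ≠ n}.Finite := by
  refine (Set.toFinite {j, k}).subset fun n hn => ?_
  by_contra h
  simp only [Set.mem_insert_iff, Set.mem_singleton_iff, not_or] at h
  exact hn (Equiv.swap_apply_of_ne_of_ne h.1 h.2)

lemma exists_finite_perm_zero_one {i j : ℕ} (hij : i ≠ j) :
    ∃ σ : Equiv.Perm ℕ, {n | σ n ≠ n}.Finite ∧ σ 0 = i ∧ σ 1 = j := by
  refine ⟨Equiv.swap 0 i * Equiv.swap 1 (Equiv.swap 0 i j), ?_, ?_, ?_⟩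
  · refine ((finite_setOf_swap_ne 0 i).union
      (finite_setOf_swap_ne 1 (Equiv.swap 0 i j))).subset fun n hn => ?_
    by_contra h
    simp only [Set.mem_union, Set.mem_ofPred_eq, not_or, not_not] at h
    exact hn (by rw [Equiv.Perm.mul_apply, h.2, h.1])
  · have : Equiv.swap 0 i j ≠ 0 := fun h => hij (by
      have := congrArg (Equiv.swap 0 i) h
      rw [Equiv.swap_apply_self, Equiv.swap_apply_left] at this
      exact this.symm)
    rw [Equiv.Perm.mul_apply, Equiv.swap_apply_of_ne_of_ne zero_ne_one this.symm,
      Equiv.swap_apply_left]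
  · simp

lemma tendsto_average_of_subseq_pow_four {u : ℕ → ℝ} {l : ℝ} (hu : Monotone u)
    (h : Tendsto (fun k : ℕ => u ((k + 1) ^ 4) / ((k + 1) ^ 4 : ℕ)) atTop (𝓝 l)) :
    Tendsto (fun n => u n / n) atTop (𝓝 l) := by
  refine tendsto_div_of_monotone_of_exists_subseq_tendsto_div u l hu fun a ha =>
    ⟨fun k => (k + 1) ^ 4, ?_, ?_, h⟩
  · have h1 : Tendsto (fun k : ℕ => (1 + 1 / ((k : ℝ) + 1)) ^ 4) atTop (𝓝 ((1 + 0) ^ 4)) :=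
      (tendsto_one_div_add_atTop_nhds_zero_nat.const_add 1).pow 4
    rw [add_zero, one_pow] at h1
    filter_upwards [h1.eventually (gt_mem_nhds ha)] with k hk
    have hpos : (0 : ℝ) < (k : ℝ) + 1 := by positivity
    have : ((k : ℝ) + 1 + 1) = (1 + 1 / ((k : ℝ) + 1)) * (k + 1) := by field_simp
    push_cast
    rw [this, mul_pow]
    exact mul_le_mul_of_nonneg_right hk.le (by positivity)
  · exact (tendsto_pow_atTop (by norm_num)).comp (tendsto_add_atTop_nat 1)

section SecondMoment

variable {Ω : Type*} [MeasurableSpace Ω] {μ : Measure Ω} [IsProbabilityMeasure μ]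
  {ξ : ℕ → Ω → ℝ} {p c : ℝ}

lemma memLp_of_mem_Icc {f : Ω → ℝ} (hf : Measurable f) (h01 : ∀ ω, f ω ∈ Set.Icc (0 : ℝ) 1)
    (q : ℝ≥0∞) : MemLp f q μ :=
  MemLp.of_bound hf.aestronglyMeasurable 1 (.of_forall fun ω => by
    rw [Real.norm_of_nonneg (h01 ω).1]; exact (h01 ω).2)

lemma memLp_average (hm : ∀ i, Measurable (ξ i)) (h01 : ∀ i ω, ξ i ω ∈ Set.Icc (0 : ℝ) 1) (n : ℕ)
    (q : ℝ≥0∞) : MemLp (fun ω => (∑ i ∈ Finset.range n, ξ i ω) / n) q μ := by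
  refine memLp_of_mem_Icc (by fun_prop) (fun ω => ⟨?_, ?_⟩) q
  · exact div_nonneg (Finset.sum_nonneg fun i _ => (h01 i ω).1) n.cast_nonneg
  · refine div_le_one_of_le₀ ?_ n.cast_nonneg
    calc _ ≤ ∑ i ∈ Finset.range n, (1 : ℝ) := Finset.sum_le_sum fun i _ => (h01 i ω).2
      _ = n := by simp

lemma integral_average_mul_average (hm : ∀ i, Measurable (ξ i))
    (h01 : ∀ i ω, ξ i ω ∈ Set.Icc (0 : ℝ) 1)
    (hcov : ∀ i j, ∫ ω, ξ i ω * ξ j ω ∂μ = if i = j then p else c) {n m : ℕ} (hn : 0 < n)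
    (hnm : n ≤ m) :
    ∫ ω, ((∑ i ∈ Finset.range n, ξ i ω) / n) * ((∑ j ∈ Finset.range m, ξ j ω) / m) ∂μ
      = c + (p - c) / m := by
  have hint (i j : ℕ) : Integrable (fun ω => ξ i ω * ξ j ω) μ :=
    (memLp_of_mem_Icc (hm i) (h01 i) 2).integrable_mul (memLp_of_mem_Icc (hm j) (h01 j) 2)
  have hm1 : 0 < m := hn.trans_le hnm
  have hm0 : (m : ℝ) ≠ 0 := by positivity
  have hn0 : (n : ℝ) ≠ 0 := by positivity
  simp_rw [div_mul_div_comm, Finset.sum_mul_sum]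
  rw [integral_div, integral_finsetSum _ fun i _ => integrable_finsetSum _ fun j _ => hint i j]
  simp_rw [integral_finsetSum _ fun j _ => hint _ j, hcov]
  have hrow (i : ℕ) (hi : i ∈ Finset.range n) :
      (∑ j ∈ Finset.range m, if i = j then p else c) = m * c + (p - c) := by
    have (j : ℕ) : (if i = j then p else c) = c + if i = j then p - c else 0 := by
      split_ifs <;> ring
    simp_rw [this, Finset.sum_add_distrib]
    rw [Finset.sum_ite_eq, if_pos (Finset.mem_range.2 ((Finset.mem_range.1 hi).trans_le hnm))]
    simp
  rw [Finset.sum_congr rfl hrow]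
  simp only [Finset.sum_const, Finset.card_range, nsmul_eq_mul]
  field_simp

lemma integral_sq_average_sub_average_le (hm : ∀ i, Measurable (ξ i))
    (h01 : ∀ i ω, ξ i ω ∈ Set.Icc (0 : ℝ) 1)
    (hcov : ∀ i j, ∫ ω, ξ i ω * ξ j ω ∂μ = if i = j then p else c) {n m : ℕ} (hn : 0 < n)
    (hnm : n ≤ m) :
    ∫ ω, ((∑ i ∈ Finset.range n, ξ i ω) / n - (∑ j ∈ Finset.range m, ξ j ω) / m) ^ 2 ∂μ
      ≤ 1 / n := by
  have hint (i j : ℕ) : Integrable (fun ω =>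
      ((∑ k ∈ Finset.range i, ξ k ω) / i) * ((∑ k ∈ Finset.range j, ξ k ω) / j)) μ :=
    (memLp_average hm h01 i 2).integrable_mul (memLp_average hm h01 j 2)
  have hsq (i j : ℕ) := integral_average_mul_average hm h01 hcov (n := i) (m := j)
  have hc : 0 ≤ c := by
    have := hcov 0 1
    simp only [zero_ne_one, if_false] at this
    rw [← this]
    exact integral_nonneg fun ω => mul_nonneg (h01 0 ω).1 (h01 1 ω).1
  have hp : p ≤ 1 := by
    have := hcov 0 0
    simp only [if_true] at this
    rw [← this]
    calc _ ≤ ∫ _, (1 : ℝ) ∂μ := integral_mono_of_nonneg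
          (.of_forall fun ω => mul_nonneg (h01 0 ω).1 (h01 0 ω).1) (integrable_const _)
          (.of_forall fun ω => mul_le_one₀ (h01 0 ω).2 (h01 0 ω).1 (h01 0 ω).2)
      _ = 1 := by simp
  have hexp : ∫ ω, ((∑ i ∈ Finset.range n, ξ i ω) / n - (∑ j ∈ Finset.range m, ξ j ω) / m) ^ 2 ∂μ
      = (p - c) * (1 / n - 1 / m) := by
    have : ∀ a b : ℝ, (a - b) ^ 2 = a * a - 2 * (a * b) + b * b := fun a b => by ring
    simp_rw [this]
    have hsub : Integrable (fun ω =>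
        ((∑ k ∈ Finset.range n, ξ k ω) / n) * ((∑ k ∈ Finset.range n, ξ k ω) / n)
          - 2 * (((∑ k ∈ Finset.range n, ξ k ω) / n) * ((∑ k ∈ Finset.range m, ξ k ω) / m))) μ :=
      (hint n n).sub ((hint n m).const_mul 2)
    rw [integral_add hsub (hint m m),
      integral_sub (hint n n) ((hint n m).const_mul 2), integral_const_mul, hsq n n hn le_rfl,
      hsq n m hn hnm, hsq m m (hn.trans_le hnm) le_rfl]
    ring
  rw [hexp]
  have hmn : (1 : ℝ) / m ≤ 1 / n :=
    one_div_le_one_div_of_le (by exact_mod_cast hn) (by exact_mod_cast hnm)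
  have hm' : (0 : ℝ) ≤ 1 / m := by positivity
  nlinarith

lemma eLpNorm_average_sub_average_le (hm : ∀ i, Measurable (ξ i))
    (h01 : ∀ i ω, ξ i ω ∈ Set.Icc (0 : ℝ) 1)
    (hcov : ∀ i j, ∫ ω, ξ i ω * ξ j ω ∂μ = if i = j then p else c) {k n m : ℕ} (hk : 0 < k)
    (hn : k ^ 4 ≤ n) (hnm : n ≤ m) :
    eLpNorm ((fun ω => (∑ i ∈ Finset.range n, ξ i ω) / (n : ℝ))
      - fun ω => (∑ j ∈ Finset.range m, ξ j ω) / (m : ℝ)) 2 μ ≤ ENNReal.ofReal (1 / (k : ℝ) ^ 2) := by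
  have hk4 : 0 < k ^ 4 := by positivity
  have h := integral_sq_average_sub_average_le hm h01 hcov (hk4.trans_le hn) hnm
  rw [((memLp_average hm h01 n 2).sub (memLp_average hm h01 m 2)).eLpNorm_eq_integral_rpow_norm
    (by norm_num) (by norm_num)]
  refine ENNReal.ofReal_le_ofReal ?_
  simp only [Pi.sub_apply, ENNReal.toReal_ofNat, Real.rpow_ofNat, Real.norm_eq_abs, sq_abs]
  rw [← one_div, ← Real.sqrt_eq_rpow]
  refine Real.sqrt_le_iff.2 ⟨by positivity, h.trans ?_⟩
  have hk4' : (0 : ℝ) < (k : ℝ) ^ 4 := by positivity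
  calc (1 : ℝ) / n ≤ 1 / (k : ℝ) ^ 4 := one_div_le_one_div_of_le hk4' (by exact_mod_cast hn)
    _ = (1 / (k : ℝ) ^ 2) ^ 2 := by rw [div_pow, one_pow, ← pow_mul]

/-- Strong law of large numbers for `[0, 1]`-valued variables whose second moments have the
pattern of an exchangeable sequence. -/
lemma ae_exists_tendsto_average (hm : ∀ i, Measurable (ξ i))
    (h01 : ∀ i ω, ξ i ω ∈ Set.Icc (0 : ℝ) 1)
    (hcov : ∀ i j, ∫ ω, ξ i ω * ξ j ω ∂μ = if i = j then p else c) :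
    ∀ᵐ ω ∂μ, ∃ l, Tendsto (fun n : ℕ => (∑ i ∈ Finset.range n, ξ i ω) / n) atTop (𝓝 l) := by
  have hsum : ∑' k : ℕ, ENNReal.ofReal (2 / ((k : ℝ) + 1) ^ 2) ≠ ∞ := by
    have hs : Summable fun k : ℕ => 2 / ((k : ℝ) + 1) ^ 2 := by
      have := ((summable_nat_add_iff 1).2
        (Real.summable_one_div_nat_pow.2 (by norm_num : 1 < 2))).mul_left 2
      refine this.congr fun k => ?_
      push_cast
      ring
    exact hs.tsum_ofReal_ne_top
  have hcauchy := Lp.ae_tendsto_of_cauchy_eLpNorm (μ := μ) (p := 2)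
    (f := fun k ω => (∑ i ∈ Finset.range ((k + 1) ^ 4), ξ i ω) / ((k + 1) ^ 4 : ℕ))
    (fun k => (memLp_average hm h01 _ 2).1) (by norm_num) hsum fun N n m hn hmN => ?_
  · filter_upwards [hcauchy] with ω ⟨l, hl⟩
    refine ⟨l, tendsto_average_of_subseq_pow_four ?_ hl⟩
    exact fun a b hab => Finset.sum_le_sum_of_subset_of_nonneg
      (Finset.range_subset_range.2 hab) fun i _ _ => (h01 i ω).1
  · have hlt : ENNReal.ofReal (1 / ((N + 1 : ℕ) : ℝ) ^ 2)
        < ENNReal.ofReal (2 / ((N : ℝ) + 1) ^ 2) := by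
      push_cast
      rw [ENNReal.ofReal_lt_ofReal_iff (by positivity)]
      gcongr
      norm_num
    refine lt_of_le_of_lt ?_ hlt
    have hpow {a b : ℕ} (hab : a ≤ b) : (a + 1) ^ 4 ≤ (b + 1) ^ 4 := by gcongr
    rcases le_total n m with hnm | hnm
    · exact eLpNorm_average_sub_average_le hm h01 hcov N.succ_pos (hpow hn) (hpow hnm)
    · rw [eLpNorm_sub_comm]
      exact eLpNorm_average_sub_average_le hm h01 hcov N.succ_pos (hpow hmN) (hpow hnm)

end SecondMoment

section Exchangeable

variable {Ω 𝕏 : Type*} [MeasurableSpace Ω] [MeasurableSpace 𝕏] {μ : Measure Ω}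
  {X : ℕ → Ω → 𝕏}

lemma Exchangeable.integral_perm (hexch : Exchangeable μ X) (hX : ∀ n, Measurable (X n))
    {σ : Equiv.Perm ℕ} (hσ : {n | σ n ≠ n}.Finite) {g : (ℕ → 𝕏) → ℝ} (hg : Measurable g) :
    ∫ ω, g (fun n => X (σ n) ω) ∂μ = ∫ ω, g (fun n => X n ω) ∂μ := by
  rw [← integral_map (measurable_pi_lambda _ fun n => hX (σ n)).aemeasurable
      hg.aestronglyMeasurable, hexch σ hσ,
    integral_map (measurable_pi_lambda _ hX).aemeasurable hg.aestronglyMeasurable]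

lemma Exchangeable.measureReal_inter_preimage (hexch : Exchangeable μ X)
    (hX : ∀ n, Measurable (X n)) {s : Set 𝕏} (hs : MeasurableSet s) {C : Set (ℕ → 𝕏)}
    (hC : MeasurableSet C) {j k : ℕ}
    (hCinv : ∀ x : ℕ → 𝕏, (fun n => x (Equiv.swap j k n)) ∈ C ↔ x ∈ C) :
    μ.real ((fun ω n => X n ω) ⁻¹' C ∩ X j ⁻¹' s)
      = μ.real ((fun ω n => X n ω) ⁻¹' C ∩ X k ⁻¹' s) := by
  have hD : MeasurableSet (C ∩ {x | x j ∈ s}) := hC.inter (measurable_pi_apply j hs)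
  have h := congrArg (fun ν => ν (C ∩ {x | x j ∈ s})) (hexch _ (finite_setOf_swap_ne j k))
  simp only [Measure.map_apply (measurable_pi_lambda _ fun n => hX (Equiv.swap j k n)) hD,
    Measure.map_apply (measurable_pi_lambda _ hX) hD] at h
  rw [measureReal_def, measureReal_def]
  congr 1
  refine Eq.trans h.symm (congrArg μ ?_)
  ext ω
  simp [hCinv (fun n => X n ω)]

variable [IsProbabilityMeasure μ]

lemma Exchangeable.ae_tendsto_sampleFreq (hexch : Exchangeable μ X)
    (hX : ∀ n, Measurable (X n)) {s : Set 𝕏} (hs : MeasurableSet s) :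
    ∀ᵐ ω ∂μ, Tendsto (fun n => sampleFreq s n (fun k => X k ω)) atTop
      (𝓝 (limFreq s (fun k => X k ω))) := by
  have hind (i : ℕ) : Measurable (fun x : ℕ → 𝕏 => s.indicator (fun _ => (1 : ℝ)) (x i)) :=
    (measurable_const.indicator hs).comp (measurable_pi_apply i)
  have hcov (i j : ℕ) :
      ∫ ω, s.indicator (fun _ => (1 : ℝ)) (X i ω) * s.indicator (fun _ => (1 : ℝ)) (X j ω) ∂μ
        = if i = j then
            ∫ ω, s.indicator (fun _ => (1 : ℝ)) (X 0 ω) * s.indicator (fun _ => (1 : ℝ)) (X 0 ω) ∂μ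
          else
            ∫ ω, s.indicator (fun _ => (1 : ℝ)) (X 0 ω) * s.indicator (fun _ => (1 : ℝ)) (X 1 ω) ∂μ
      := by
    split_ifs with hij
    · subst hij
      have := hexch.integral_perm hX (finite_setOf_swap_ne 0 i) ((hind 0).mul (hind 0))
      simpa using this
    · obtain ⟨σ, hσ, h0, h1⟩ := exists_finite_perm_zero_one hij
      have := hexch.integral_perm hX hσ ((hind 0).mul (hind 1))
      simpa [h0, h1] using this
  filter_upwards [ae_exists_tendsto_average
    (ξ := fun i ω => s.indicator (fun _ => (1 : ℝ)) (X i ω))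
    (fun i => (measurable_const.indicator hs).comp (hX i))
    (fun i ω => indicator_one_mem_Icc s (X i ω)) hcov] with ω ⟨l, hl⟩
  have hl' : Tendsto (fun n => sampleFreq s n (fun k => X k ω)) atTop (𝓝 l) := hl
  rwa [limFreq, hl'.limsup_eq]

lemma integrable_limFreq (hX : ∀ n, Measurable (X n)) {s : Set 𝕏} (hs : MeasurableSet s) :
    Integrable (fun ω => limFreq s (fun k => X k ω)) μ :=
  Integrable.of_bound
    ((measurable_limFreq hs).comp (measurable_pi_lambda _ hX)).aestronglyMeasurable 1
    (.of_forall fun _ => norm_limFreq_le_one s _)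

lemma Exchangeable.setIntegral_limFreq (hexch : Exchangeable μ X)
    (hX : ∀ n, Measurable (X n)) {s : Set 𝕏} (hs : MeasurableSet s) {B : Set Ω}
    {a : ℝ} (h : ∀ᶠ j in atTop, μ.real (B ∩ X j ⁻¹' s) = a) :
    ∫ ω in B, limFreq s (fun k => X k ω) ∂μ = a := by
  have hZ : Measurable (fun ω k => X k ω) := measurable_pi_lambda _ hX
  have hlim : Tendsto (fun n => ∫ ω in B, sampleFreq s n (fun k => X k ω) ∂μ) atTop
      (𝓝 (∫ ω in B, limFreq s (fun k => X k ω) ∂μ)) :=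
    tendsto_integral_of_dominated_convergence (fun _ => 1)
      (fun n => ((measurable_sampleFreq hs n).comp hZ).aestronglyMeasurable)
      (integrable_const _) (fun n => .of_forall fun _ => norm_sampleFreq_le_one s n _)
      (ae_restrict_of_ae (hexch.ae_tendsto_sampleFreq hX hs))
  have havg (n : ℕ) : ∫ ω in B, sampleFreq s n (fun k => X k ω) ∂μ
      = (n : ℝ)⁻¹ * ∑ j ∈ Finset.range n, μ.real (B ∩ X j ⁻¹' s) := by
    have hfun (j : ℕ) : (fun ω => s.indicator (fun _ => (1 : ℝ)) (X j ω))
        = (X j ⁻¹' s).indicator (fun _ => (1 : ℝ)) := rfl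
    have hint (j : ℕ) : Integrable (fun ω => s.indicator (fun _ => (1 : ℝ)) (X j ω))
        (μ.restrict B) := by
      rw [hfun]
      exact (integrable_const _).indicator (hX j hs)
    unfold sampleFreq
    rw [integral_div, integral_finsetSum _ fun j _ => hint j, div_eq_inv_mul]
    congr 1
    refine Finset.sum_congr rfl fun j _ => ?_
    rw [hfun, integral_indicator_const _ (hX j hs), smul_eq_mul, mul_one,
      measureReal_restrict_apply (hX j hs), Set.inter_comm]
  simp_rw [havg] at hlim
  have hconst : Tendsto (fun j => μ.real (B ∩ X j ⁻¹' s)) atTop (𝓝 a) :=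
    tendsto_const_nhds.congr' (h.mono fun j hj => hj.symm)
  exact tendsto_nhds_unique hlim hconst.cesaro

lemma Exchangeable.limFreq_ae_eq_condExp (hexch : Exchangeable μ X)
    (hX : ∀ n, Measurable (X n)) {s : Set 𝕏} (hs : MeasurableSet s) {ι : Type*}
    (U : ι → Set 𝕏) (hU : ∀ t, MeasurableSet (U t)) {t : ι} (hst : s = U t) :
    (fun ω => limFreq s (fun k => X k ω)) =ᵐ[μ]
      μ⟦X 0 ⁻¹' s | MeasurableSpace.comap (fun ω t => limFreq (U t) (fun k => X k ω)) inferInstance⟧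
    := by
  have hg : Measurable (fun (x : ℕ → 𝕏) t => limFreq (U t) x) :=
    measurable_pi_lambda _ fun t => measurable_limFreq (hU t)
  have hY : Measurable (fun ω t => limFreq (U t) (fun k => X k ω)) :=
    hg.comp (measurable_pi_lambda _ hX)
  refine ae_eq_condExp_of_forall_setIntegral_eq hY.comap_le
    ((integrable_const _).indicator (hX 0 hs))
    (fun _ _ _ => (integrable_limFreq hX hs).integrableOn) ?_ ?_
  · rintro _ ⟨D, hD, rfl⟩ -
    rw [integral_indicator_const _ (hX 0 hs), smul_eq_mul, mul_one,
      measureReal_restrict_apply (hX 0 hs), Set.inter_comm]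
    refine hexch.setIntegral_limFreq hX hs (.of_forall fun j => ?_)
    refine hexch.measureReal_inter_preimage hX hs (hg hD) fun x => ?_
    simp only [Set.mem_preimage, limFreq_perm _ x (finite_setOf_swap_ne j 0)]
  · subst hst
    exact (((measurable_pi_apply t).comp
      (comap_measurable fun ω t => limFreq (U t) (fun k => X k ω)))).aestronglyMeasurable

/-- The filtration whose `n`-th σ-algebra is generated by the first `n` terms of a sequence. -/
def prefixFiltration (hX : ∀ n, Measurable (X n)) : Filtration ℕ ‹MeasurableSpace Ω› where
  seq n := MeasurableSpace.comap (fun ω (i : Fin n) => X i ω) inferInstance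
  mono' n m hnm := by
    have hr : Measurable (fun (x : Fin m → 𝕏) (i : Fin n) => x (Fin.castLE hnm i)) :=
      measurable_pi_lambda _ fun i => measurable_pi_apply _
    rintro _ ⟨B, hB, rfl⟩
    exact ⟨_, hr hB, rfl⟩
  le' n := (measurable_pi_lambda _ fun i : Fin n => hX i).comap_le

lemma measurable_iSup_prefixFiltration (hX : ∀ n, Measurable (X n)) :
    Measurable[⨆ n, prefixFiltration hX n] (fun ω k => X k ω) := by
  refine @measurable_pi_lambda _ _ _ (⨆ n, prefixFiltration hX n) _ _ fun k => ?_
  have h : Measurable[prefixFiltration hX (k + 1)] (X k) :=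
    (measurable_pi_apply (Fin.last k)).comp
      (comap_measurable fun ω (i : Fin (k + 1)) => X i ω)
  exact h.mono (le_iSup (prefixFiltration hX) (k + 1)) le_rfl

lemma IsPredictiveRule.ae_eq_condExp_limFreq (hexch : Exchangeable μ X)
    (hX : ∀ n, Measurable (X n)) {P : (n : ℕ) → Kernel (Fin n → 𝕏) 𝕏}
    (hP : ∀ n, IsMarkovKernel (P n)) (hpred : IsPredictiveRule μ X P) {s : Set 𝕏}
    (hs : MeasurableSet s) (n : ℕ) :
    (fun ω => (P n (fun i : Fin n => X i ω)).real s) =ᵐ[μ]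
      μ[fun ω => limFreq s (fun k => X k ω) | prefixFiltration hX n] := by
  have := hP n
  have hZ : Measurable (fun ω (i : Fin n) => X i ω) := measurable_pi_lambda _ fun i => hX i
  have hPs : Measurable (fun x => P n x s) := (P n).measurable_coe hs
  have hmeas : Measurable (fun ω => (P n (fun i : Fin n => X i ω)).real s) :=
    (hPs.comp hZ).ennreal_toReal
  refine ae_eq_condExp_of_forall_setIntegral_eq ((prefixFiltration hX).le n)
    (integrable_limFreq hX hs) (fun _ _ _ => ?_) ?_ ?_
  · exact (Integrable.of_bound hmeas.aestronglyMeasurable 1 (.of_forall fun ω => by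
      rw [Real.norm_of_nonneg measureReal_nonneg]
      exact measureReal_le_one)).integrableOn
  · rintro _ ⟨B, hB, rfl⟩ -
    have hr : Measurable (fun (x : ℕ → 𝕏) (i : Fin n) => x i) :=
      measurable_pi_lambda _ fun i => measurable_pi_apply _
    have hlim := hexch.setIntegral_limFreq hX hs (B := (fun ω (i : Fin n) => X i ω) ⁻¹' B)
      (a := μ.real ((fun ω (i : Fin n) => X i ω) ⁻¹' B ∩ X n ⁻¹' s)) (by
        filter_upwards [eventually_ge_atTop n] with j hj
        refine hexch.measureReal_inter_preimage hX hs (hr hB) fun x => ?_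
        have (i : Fin n) : Equiv.swap j n i = i :=
          Equiv.swap_apply_of_ne_of_ne (by omega) (by omega)
        simp [this])
    rw [hlim, measureReal_def]
    have h := hpred n s B hs hB
    rw [setLIntegral_map hB hPs hZ] at h
    have hset : (fun ω (i : Fin n) => X i ω) ⁻¹' B ∩ X n ⁻¹' s
        = {ω | (fun i : Fin n => X i ω) ∈ B ∧ X n ω ∈ s} := rfl
    rw [hset, h]
    exact integral_toReal (hPs.comp hZ).aemeasurable (.of_forall fun ω => measure_lt_top _ _)
  · exact (hPs.ennreal_toReal.comp
      (comap_measurable fun ω (i : Fin n) => X i ω)).aestronglyMeasurable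

lemma IsPredictiveRule.ae_tendsto_limFreq (hexch : Exchangeable μ X)
    (hX : ∀ n, Measurable (X n)) {P : (n : ℕ) → Kernel (Fin n → 𝕏) 𝕏}
    (hP : ∀ n, IsMarkovKernel (P n)) (hpred : IsPredictiveRule μ X P) {s : Set 𝕏}
    (hs : MeasurableSet s) :
    ∀ᵐ ω ∂μ, Tendsto (fun n => (P n (fun i : Fin n => X i ω)).real s) atTop
      (𝓝 (limFreq s (fun k => X k ω))) := by
  have hlevy := (integrable_limFreq (μ := μ) hX hs).tendsto_ae_condExp
    (ℱ := prefixFiltration hX)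
    ((measurable_limFreq hs).comp (measurable_iSup_prefixFiltration hX)).stronglyMeasurable
  filter_upwards [hlevy, ae_all_iff.2 fun n => hpred.ae_eq_condExp_limFreq hexch hX hP hs n]
    with ω hω hn
  exact hω.congr fun n => (hn n).symm


end Exchangeable

lemma empMeas_real {Ω 𝕏 : Type*} [MeasurableSpace Ω] [MeasurableSpace 𝕏] (X : ℕ → Ω → 𝕏) (n : ℕ)
    (ω : Ω) {s : Set 𝕏} (hs : MeasurableSet s) :
    (empMeas X n ω).real s = sampleFreq s n (fun k => X k ω) := by
  have hdirac (i : ℕ) : (Measure.dirac (X i ω) s).toReal = s.indicator (fun _ => (1 : ℝ)) (X i ω) := by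
    rw [Measure.dirac_apply' _ hs]
    by_cases h : X i ω ∈ s <;> simp [h]
  rw [measureReal_def, empMeas, Measure.smul_apply, Measure.finsetSum_apply, smul_eq_mul,
    ENNReal.toReal_mul, ENNReal.toReal_sum fun i _ => measure_ne_top _ _]
  simp_rw [hdirac]
  simp [sampleFreq, div_eq_inv_mul]

lemma isProbabilityMeasure_empMeas {Ω 𝕏 : Type*} [MeasurableSpace Ω] [MeasurableSpace 𝕏]
    (X : ℕ → Ω → 𝕏) {n : ℕ} (hn : n ≠ 0) (ω : Ω) : IsProbabilityMeasure (empMeas X n ω) := by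
  refine ⟨?_⟩
  simp only [empMeas, Measure.smul_apply, Measure.finsetSum_apply, measure_univ, smul_eq_mul,
    Finset.sum_const, Finset.card_range, nsmul_eq_mul, mul_one]
  exact ENNReal.inv_mul_cancel (by exact_mod_cast hn) (ENNReal.natCast_ne_top n)

/-- Finite intersections of elements of the standard countable basis of the topology. -/
def basisInter (𝕏 : Type*) [TopologicalSpace 𝕏] [SecondCountableTopology 𝕏]
    (t : Finset (TopologicalSpace.countableBasis 𝕏)) : Set 𝕏 :=
  ⋂ b ∈ t, (b : Set 𝕏)

section Weak

variable {𝕏 : Type*} [TopologicalSpace 𝕏] [SecondCountableTopology 𝕏]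

lemma isOpen_basisInter (t : Finset (TopologicalSpace.countableBasis 𝕏)) :
    IsOpen (basisInter 𝕏 t) :=
  isOpen_biInter_finset fun b _ => TopologicalSpace.isOpen_of_mem_countableBasis b.2

lemma tendstoWeakly_of_forall_basisInter [MeasurableSpace 𝕏] [BorelSpace 𝕏]
    [HasOuterApproxClosed 𝕏] {ν : ℕ → Measure 𝕏} {ρ : Measure 𝕏} [IsProbabilityMeasure ρ]
    (hν : ∀ n ≠ 0, IsProbabilityMeasure (ν n))
    (h : ∀ t, Tendsto (fun n => (ν n).real (basisInter 𝕏 t)) atTop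
      (𝓝 (ρ.real (basisInter 𝕏 t)))) :
    TendstoWeakly ν ρ := by
  classical
  intro f
  let ν' (n : ℕ) : ProbabilityMeasure 𝕏 := ⟨ν (n + 1), hν _ n.succ_ne_zero⟩
  let ρ' : ProbabilityMeasure 𝕏 := ⟨ρ, inferInstance⟩
  have hpi : IsPiSystem (Set.range (basisInter 𝕏)) := by
    rintro _ ⟨t, rfl⟩ _ ⟨t', rfl⟩ -
    exact ⟨t ∪ t', by ext x; simp [basisInter, or_imp, forall_and]⟩
  have key : Tendsto ν' atTop (𝓝 ρ') := by
    refine hpi.tendsto_probabilityMeasure_of_tendsto_of_mem ?_ ?_ ?_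
    · rintro _ ⟨t, rfl⟩
      exact (isOpen_basisInter t).measurableSet
    · intro u hu x hx
      obtain ⟨b, hb, hxb, hbu⟩ :=
        (TopologicalSpace.isBasis_countableBasis 𝕏).exists_subset_of_mem_open hx hu
      refine ⟨_, ⟨{⟨b, hb⟩}, rfl⟩, (isOpen_basisInter _).mem_nhds ?_, ?_⟩ <;>
        simpa [basisInter]
    · rintro _ ⟨t, rfl⟩
      rw [← NNReal.tendsto_coe]
      exact (h t).comp (tendsto_add_atTop_nat 1)
  have := ProbabilityMeasure.tendsto_iff_forall_integral_tendsto.1 key f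
  exact (tendsto_add_atTop_iff_nat 1).1 this

end Weak

/-- For an exchangeable sequence, with probability one the predictive distributions converge
weakly, and their limit coincides with the limit `F̃` of the empirical distributions. -/
theorem statement2
    {Ω 𝕏 : Type*} [MeasurableSpace Ω] [MeasurableSpace 𝕏] [TopologicalSpace 𝕏]
    [PolishSpace 𝕏] [BorelSpace 𝕏]
    (μ : Measure Ω) [IsProbabilityMeasure μ]
    (X : ℕ → Ω → 𝕏) (hX : ∀ n, Measurable (X n))
    (hexch : Exchangeable μ X)
    (P : (n : ℕ) → Kernel (Fin n → 𝕏) 𝕏) (hP : ∀ n, IsMarkovKernel (P n))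
    (hpred : IsPredictiveRule μ X P) :
    ∃ F : Ω → Measure 𝕏,
      Measurable F ∧
      (∀ ω, IsProbabilityMeasure (F ω)) ∧
      (∀ᵐ ω ∂μ, TendstoWeakly (fun n => empMeas X n ω) (F ω)) ∧
      (∀ᵐ ω ∂μ, TendstoWeakly (fun n => P n (fun i : Fin n => X i ω)) (F ω)) := by
  have : Nonempty 𝕏 := (nonempty_of_isProbabilityMeasure μ).map (X 0)
  have hU (t) : MeasurableSet (basisInter 𝕏 t) := (isOpen_basisInter t).measurableSet
  let Y : Ω → Finset (TopologicalSpace.countableBasis 𝕏) → ℝ :=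
    fun ω t => limFreq (basisInter 𝕏 t) (fun k => X k ω)
  have hY : Measurable Y := measurable_pi_lambda _ fun t =>
    (measurable_limFreq (hU t)).comp (measurable_pi_lambda _ hX)
  have hF : ∀ᵐ ω ∂μ, ∀ t, (condDistrib (X 0) Y μ (Y ω)).real (basisInter 𝕏 t)
      = limFreq (basisInter 𝕏 t) (fun k => X k ω) :=
    ae_all_iff.2 fun t => (condDistrib_ae_eq_condExp hY (hX 0) (hU t)).trans
      (hexch.limFreq_ae_eq_condExp hX (hU t) (basisInter 𝕏) hU rfl).symm
  refine ⟨fun ω => condDistrib (X 0) Y μ (Y ω), (Kernel.measurable _).comp hY,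
    fun ω => inferInstance, ?_, ?_⟩
  · filter_upwards [hF, ae_all_iff.2 fun t => hexch.ae_tendsto_sampleFreq hX (hU t)] with ω hω hlim
    refine tendstoWeakly_of_forall_basisInter
      (fun n hn => isProbabilityMeasure_empMeas X hn ω) fun t => ?_
    simp_rw [hω t, empMeas_real X _ ω (hU t)]
    exact hlim t
  · filter_upwards [hF, ae_all_iff.2 fun t => hpred.ae_tendsto_limFreq hexch hX hP (hU t)]
      with ω hω hlim
    refine tendstoWeakly_of_forall_basisInter
      (fun n _ => (hP n).isProbabilityMeasure _) fun t => ?_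
    simp_rw [hω t]
    exact hlim t
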